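/- arXiv:2411.02520 — 3 statements merged into one kernel-verified Lean document; each statement's English description precedes it below -/
import Mathlib

section
/- For every ρ ∈ (−1,1), the rate functions satisfy the two-sided bound (1/(1+|ρ|)) · I₀(S₀,V₀,K) ≤ I_ρ(S₀,V₀,K) ≤ (1/(1−|ρ|)) · I₀(S₀,V₀,K), where I₀(S₀,V₀,K) denotes the rate function with ρ = 0. -/
open MeasureTheory

/-- `f : [0,1] → ℝ` is absolutely continuous with square-integrable derivative `f'`. -/
def AC (f f' : ℝ → ℝ) : Prop :=
  IntervalIntegrable f' MeasureTheory.volume 0 1 ∧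
  IntervalIntegrable (fun t => (f' t) ^ 2) MeasureTheory.volume 0 1 ∧
  ∀ t ∈ Set.Icc (0 : ℝ) 1, f t = f 0 + ∫ s in (0 : ℝ)..t, f' s

/-- The functional `Λ_ρ[g,h]` (with chosen derivatives `g'`, `h'`). -/
noncomputable def Lam (η σ : ℝ → ℝ) (ρ : ℝ) (g g' h h' : ℝ → ℝ) : ℝ :=
  (1 / (2 * (1 - ρ ^ 2))) *
    (∫ t in (0 : ℝ)..1,
      (g' t / (η (Real.exp (g t)) * Real.sqrt (Real.exp (h t))) -
        ρ * h' t / σ (Real.exp (h t))) ^ 2) +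
  (1 / 2) * (∫ t in (0 : ℝ)..1, (h' t / σ (Real.exp (h t))) ^ 2)

/-- Admissible values of the variational problem defining the rate function. -/
def RateValues (η σ : ℝ → ℝ) (ρ S₀ V₀ K : ℝ) : Set ℝ :=
  {y | ∃ g g' h h' : ℝ → ℝ, AC g g' ∧ AC h h' ∧
    g 0 = Real.log S₀ ∧ h 0 = Real.log V₀ ∧
    (∫ t in (0 : ℝ)..1, Real.exp (h t) * (η (Real.exp (g t))) ^ 2) = K ∧
    y = Lam η σ ρ g g' h h'}

/-- The rate function `I_ρ(S₀,V₀,K)`. -/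
noncomputable def RateI (η σ : ℝ → ℝ) (ρ S₀ V₀ K : ℝ) : ℝ :=
  sInf (RateValues η σ ρ S₀ V₀ K)

lemma AC.continuousOn {f f' : ℝ → ℝ} (hf : AC f f') : ContinuousOn f (Set.Icc 0 1) := by
  have h := intervalIntegral.continuousOn_primitive_interval' hf.1
    (Set.left_mem_uIcc (a := (0 : ℝ)) (b := 1))
  rw [Set.uIcc_of_le zero_le_one] at h
  exact (continuousOn_const.add h).congr hf.2.2

lemma ContinuousOn.comp_exp_Ioi {φ f : ℝ → ℝ} {s : Set ℝ} (hφ : ContinuousOn φ (Set.Ioi 0))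
    (hf : ContinuousOn f s) : ContinuousOn (fun t => φ (Real.exp (f t))) s :=
  hφ.comp (Real.continuous_exp.comp_continuousOn hf) fun t _ => Real.exp_pos (f t)

/-- Dividing an `L²` derivative by a nonvanishing continuous weight keeps it in `L²`. -/
lemma AC.memLp_div {f f' w : ℝ → ℝ} (hf : AC f f') (hw : ContinuousOn w (Set.Icc 0 1))
    (hw0 : ∀ t, w t ≠ 0) :
    MemLp (fun t => f' t / w t) 2 (volume.restrict (Set.Ioc 0 1)) := by
  have hc : ContinuousOn (fun t => (w t)⁻¹) (Set.uIcc 0 1) := by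
    rw [Set.uIcc_of_le zero_le_one]
    exact hw.inv₀ fun t _ => hw0 t
  have h1 := hf.1.mul_continuousOn hc
  have h2 := hf.2.1.mul_continuousOn (hc.pow 2)
  rw [intervalIntegrable_iff_integrableOn_Ioc_of_le zero_le_one] at h1 h2
  simp only [div_eq_mul_inv]
  refine (memLp_two_iff_integrable_sq h1.aestronglyMeasurable).2 ?_
  simpa only [mul_pow, Pi.pow_apply] using h2.integrable

lemma integral_sub_const_mul_sq {A B : ℝ → ℝ}
    (hA : MemLp A 2 (volume.restrict (Set.Ioc 0 1)))
    (hB : MemLp B 2 (volume.restrict (Set.Ioc 0 1))) (c : ℝ) :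
    ∫ t in (0 : ℝ)..1, (A t - c * B t) ^ 2 =
      (∫ t in (0 : ℝ)..1, A t ^ 2) - 2 * c * (∫ t in (0 : ℝ)..1, A t * B t) +
        c ^ 2 * ∫ t in (0 : ℝ)..1, B t ^ 2 := by
  simp only [intervalIntegral.integral_of_le zero_le_one]
  have hAB : Integrable (fun t => A t * B t) (volume.restrict (Set.Ioc 0 1)) :=
    hA.integrable_mul hB
  have hA2 := hA.integrable_sq
  have hB2 := hB.integrable_sq
  rw [← integral_const_mul, ← integral_const_mul, ← integral_sub hA2 (hAB.const_mul _),
    ← integral_add (by exact hA2.sub (hAB.const_mul _)) (hB2.const_mul _)]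
  congr 1
  ext t
  ring

/-- The quadratic form `(x - 2ρy + z) / (1 - ρ²)` is comparable to `x + z` when `2|y| ≤ x + z`. -/
lemma quadratic_form_bounds {ρ x y z : ℝ} (hρ : |ρ| < 1) (hy : 2 * |y| ≤ x + z) :
    (1 / (1 + |ρ|)) * ((1 / 2) * x + (1 / 2) * z) ≤
        (1 / (2 * (1 - ρ ^ 2))) * (x - 2 * ρ * y + ρ ^ 2 * z) + (1 / 2) * z ∧
      (1 / (2 * (1 - ρ ^ 2))) * (x - 2 * ρ * y + ρ ^ 2 * z) + (1 / 2) * z ≤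
        (1 / (1 - |ρ|)) * ((1 / 2) * x + (1 / 2) * z) := by
  have h0 := abs_nonneg ρ
  have hm : 0 < 1 - |ρ| := by linarith
  have hp : 0 < 1 + |ρ| := by linarith
  have hfac : 1 - ρ ^ 2 = (1 - |ρ|) * (1 + |ρ|) := by
    rw [← sq_abs]; ring
  have hq : 0 < 1 - ρ ^ 2 := hfac ▸ mul_pos hm hp
  have hmid : (1 / (2 * (1 - ρ ^ 2))) * (x - 2 * ρ * y + ρ ^ 2 * z) + (1 / 2) * z =
      (x - 2 * ρ * y + z) / (2 * (1 - ρ ^ 2)) := by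
    field_simp
    ring
  have hlow : (1 / (1 + |ρ|)) * ((1 / 2) * x + (1 / 2) * z) =
      (1 - |ρ|) * (x + z) / (2 * (1 - ρ ^ 2)) := by
    rw [hfac]; field_simp
  have hup : (1 / (1 - |ρ|)) * ((1 / 2) * x + (1 / 2) * z) =
      (1 + |ρ|) * (x + z) / (2 * (1 - ρ ^ 2)) := by
    rw [hfac]; field_simp
  have hρy : |2 * (ρ * y)| ≤ |ρ| * (x + z) := by
    rw [abs_mul, abs_mul, abs_two]
    nlinarith [mul_le_mul_of_nonneg_left hy h0]
  obtain ⟨h1, h2⟩ := abs_le.1 hρy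
  rw [hmid, hlow, hup]
  constructor <;> gcongr <;> linarith

lemma Lam_bounds {η σ : ℝ → ℝ}
    (hηc : ContinuousOn η (Set.Ioi 0)) (hσc : ContinuousOn σ (Set.Ioi 0))
    (hη0 : ∀ x ∈ Set.Ioi (0 : ℝ), 0 < η x) (hσ0 : ∀ x ∈ Set.Ioi (0 : ℝ), 0 < σ x)
    {ρ : ℝ} (hρ : |ρ| < 1) {g g' h h' : ℝ → ℝ} (hg : AC g g') (hh : AC h h') :
    (1 / (1 + |ρ|)) * Lam η σ 0 g g' h h' ≤ Lam η σ ρ g g' h h' ∧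
      Lam η σ ρ g g' h h' ≤ (1 / (1 - |ρ|)) * Lam η σ 0 g g' h h' := by
  have hA : MemLp (fun t => g' t / (η (Real.exp (g t)) * Real.sqrt (Real.exp (h t)))) 2
      (volume.restrict (Set.Ioc 0 1)) :=
    hg.memLp_div ((hηc.comp_exp_Ioi hg.continuousOn).mul
      (Real.continuous_sqrt.continuousOn.comp_exp_Ioi hh.continuousOn))
      fun t => (mul_pos (hη0 _ (Real.exp_pos _)) (Real.sqrt_pos.2 (Real.exp_pos _))).ne'
  have hB : MemLp (fun t => h' t / σ (Real.exp (h t))) 2 (volume.restrict (Set.Ioc 0 1)) :=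
    hh.memLp_div (hσc.comp_exp_Ioi hh.continuousOn) fun t => (hσ0 _ (Real.exp_pos _)).ne'
  have key := integral_sub_const_mul_sq hA hB
  have hnn : ∀ c : ℝ, 0 ≤ ∫ t in (0 : ℝ)..1,
      (g' t / (η (Real.exp (g t)) * Real.sqrt (Real.exp (h t))) -
        c * (h' t / σ (Real.exp (h t)))) ^ 2 :=
    fun c => intervalIntegral.integral_nonneg zero_le_one fun t _ => sq_nonneg _
  have hpos := hnn 1
  have hneg := hnn (-1)
  rw [key] at hpos hneg
  have hy : 2 * |∫ t in (0 : ℝ)..1, g' t / (η (Real.exp (g t)) * Real.sqrt (Real.exp (h t))) *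
      (h' t / σ (Real.exp (h t)))| ≤
      (∫ t in (0 : ℝ)..1, (g' t / (η (Real.exp (g t)) * Real.sqrt (Real.exp (h t)))) ^ 2) +
        ∫ t in (0 : ℝ)..1, (h' t / σ (Real.exp (h t))) ^ 2 := by
    rw [← le_div_iff₀' two_pos]
    exact abs_le.2 ⟨by linarith, by linarith⟩
  have hfin := quadratic_form_bounds hρ hy
  rw [← key ρ] at hfin
  simpa only [Lam, mul_div_assoc, zero_mul, zero_div, sub_zero, ne_eq, OfNat.ofNat_ne_zero,
    not_false_eq_true, zero_pow, mul_one] using hfin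

lemma Lam_nonneg (η σ : ℝ → ℝ) {ρ : ℝ} (hρ : |ρ| < 1) (g g' h h' : ℝ → ℝ) :
    0 ≤ Lam η σ ρ g g' h h' := by
  have hq : 0 < 1 - ρ ^ 2 := sub_pos.2 ((sq_lt_one_iff_abs_lt_one ρ).2 hρ)
  have h1 := intervalIntegral.integral_nonneg (μ := volume) (zero_le_one (α := ℝ)) fun t _ =>
    sq_nonneg (g' t / (η (Real.exp (g t)) * Real.sqrt (Real.exp (h t))) -
      ρ * h' t / σ (Real.exp (h t)))
  have h2 := intervalIntegral.integral_nonneg (μ := volume) (zero_le_one (α := ℝ)) fun t _ =>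
    sq_nonneg (h' t / σ (Real.exp (h t)))
  unfold Lam
  positivity

lemma RateI_le_Lam {η σ : ℝ → ℝ} {ρ S₀ V₀ K : ℝ} (hρ : |ρ| < 1) {g g' h h' : ℝ → ℝ}
    (hg : AC g g') (hh : AC h h') (hg0 : g 0 = Real.log S₀) (hh0 : h 0 = Real.log V₀)
    (hK : (∫ t in (0 : ℝ)..1, Real.exp (h t) * (η (Real.exp (g t))) ^ 2) = K) :
    RateI η σ ρ S₀ V₀ K ≤ Lam η σ ρ g g' h h' := by
  refine csInf_le ⟨0, ?_⟩ ⟨g, g', h, h', hg, hh, hg0, hh0, hK, rfl⟩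
  rintro _ ⟨g, g', h, h', -, -, -, -, -, rfl⟩
  exact Lam_nonneg η σ hρ g g' h h'

/-- If `Λ_ρ₁ ≤ c Λ_ρ₂` on all paths, then `I_ρ₁ ≤ c I_ρ₂`, with or without admissible paths. -/
lemma RateI_le_mul_RateI {η σ : ℝ → ℝ} {ρ₁ ρ₂ c S₀ V₀ K : ℝ} (hρ₁ : |ρ₁| < 1) (hc : 0 < c)
    (hLam : ∀ g g' h h' : ℝ → ℝ, AC g g' → AC h h' →
      Lam η σ ρ₁ g g' h h' ≤ c * Lam η σ ρ₂ g g' h h') :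
    RateI η σ ρ₁ S₀ V₀ K ≤ c * RateI η σ ρ₂ S₀ V₀ K := by
  rcases (RateValues η σ ρ₂ S₀ V₀ K).eq_empty_or_nonempty with hE | hne
  · have hE₁ : RateValues η σ ρ₁ S₀ V₀ K = ∅ := by
      rw [Set.eq_empty_iff_forall_notMem] at hE ⊢
      rintro _ ⟨g, g', h, h', hg, hh, hg0, hh0, hK, -⟩
      exact hE _ ⟨g, g', h, h', hg, hh, hg0, hh0, hK, rfl⟩
    simp [RateI, hE, hE₁]
  · rw [← div_le_iff₀' hc]
    refine le_csInf hne ?_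
    rintro _ ⟨g, g', h, h', hg, hh, hg0, hh0, hK, rfl⟩
    rw [div_le_iff₀' hc]
    exact (RateI_le_Lam hρ₁ hg hh hg0 hh0 hK).trans (hLam g g' h h' hg hh)

/-- For every `ρ ∈ (−1,1)`,
`(1/(1+|ρ|)) · I₀(S₀,V₀,K) ≤ I_ρ(S₀,V₀,K) ≤ (1/(1−|ρ|)) · I₀(S₀,V₀,K)`. -/
theorem rate_function_two_sided_bound
    (S₀ V₀ K : ℝ) (hS₀ : 0 < S₀) (hV₀ : 0 < V₀) (hK : 0 < K)
    (η σ : ℝ → ℝ)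
    (hηc : ContinuousOn η (Set.Ioi 0)) (hσc : ContinuousOn σ (Set.Ioi 0))
    (mη Mη mσ Mσ : ℝ) (hmη : 0 < mη) (hmσ : 0 < mσ)
    (hηb : ∀ x ∈ Set.Ioi (0 : ℝ), mη ≤ η x ∧ η x ≤ Mη)
    (hσb : ∀ x ∈ Set.Ioi (0 : ℝ), mσ ≤ σ x ∧ σ x ≤ Mσ)
    (ρ : ℝ) (hρ : ρ ∈ Set.Ioo (-1 : ℝ) 1) :
    (1 / (1 + |ρ|)) * RateI η σ 0 S₀ V₀ K ≤ RateI η σ ρ S₀ V₀ K ∧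
      RateI η σ ρ S₀ V₀ K ≤ (1 / (1 - |ρ|)) * RateI η σ 0 S₀ V₀ K := by
  have hρ1 : |ρ| < 1 := abs_lt.2 hρ
  have hm : 0 < 1 - |ρ| := sub_pos.2 hρ1
  have hp : 0 < 1 + |ρ| := by positivity
  have hbd := fun g g' h h' (hg : AC g g') (hh : AC h h') =>
    Lam_bounds hηc hσc (fun x hx => hmη.trans_le (hηb x hx).1)
      (fun x hx => hmσ.trans_le (hσb x hx).1) hρ1 hg hh
  constructor
  · rw [one_div_mul_eq_div, div_le_iff₀' hp]
    refine RateI_le_mul_RateI (by simp) hp fun g g' h h' hg hh => ?_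
    rw [← div_le_iff₀' hp, ← one_div_mul_eq_div]
    exact (hbd g g' h h' hg hh).1
  · exact RateI_le_mul_RateI hρ1 (one_div_pos.2 hm) fun g g' h h' hg hh =>
      (hbd g g' h h' hg hh).2
end

section
/- Let η : (0,∞) → (0,∞) be continuously differentiable, let h : [0,1] → ℝ be continuously differentiable, let λ ∈ ℝ and K > 0, and let g : [0,1] → ℝ be twice continuously differentiable with g'(1) = 0 satisfying, for every t ∈ [0,1], the Euler–Lagrange equation (d/dt)( g'(t)/(η(e^{g(t)}) e^{h(t)}) ) = 2λ e^{h(t)} η²(e^{g(t)}) η'(e^{g(t)}) e^{g(t)}. Then the first-integral identity (1/2) ( g'(t)/(η(e^{g(t)}) e^{h(t)}) )² = λ ( η²(e^{g(t)}) − η²(e^{g(1)}) ) holds for every t ∈ [0,1]. Moreover, if in addition ∫₀¹ e^{h(t)} η²(e^{g(t)}) dt = K, then ∫₀¹ (1/2) ( g'(t)/(η(e^{g(t)}) √(e^{h(t)})) )² dt = λ ( K − η²(e^{g(1)}) ∫₀¹ e^{h(t)} dt ). -/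
open MeasureTheory

/-- first-integral identity for the Euler–Lagrange equation, and the
resulting value of the `g`-part of the action under the constraint
`∫₀¹ e^{h} η²(e^{g}) dt = K`. -/
theorem euler_lagrange_first_integral
    (η η' : ℝ → ℝ)
    (hηpos : ∀ x ∈ Set.Ioi (0 : ℝ), 0 < η x)
    (hη' : ∀ x ∈ Set.Ioi (0 : ℝ), HasDerivAt η (η' x) x)
    (hη'c : ContinuousOn η' (Set.Ioi 0))
    (h h' : ℝ → ℝ)
    (hh : ∀ t ∈ Set.Icc (0 : ℝ) 1, HasDerivAt h (h' t) t)
    (hh'c : ContinuousOn h' (Set.Icc (0 : ℝ) 1))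
    (lam K : ℝ) (hK : 0 < K)
    (g g' g'' : ℝ → ℝ)
    (hg : ∀ t ∈ Set.Icc (0 : ℝ) 1, HasDerivAt g (g' t) t)
    (hg' : ∀ t ∈ Set.Icc (0 : ℝ) 1, HasDerivAt g' (g'' t) t)
    (hg''c : ContinuousOn g'' (Set.Icc (0 : ℝ) 1))
    (hg'1 : g' 1 = 0)
    (hEL : ∀ t ∈ Set.Icc (0 : ℝ) 1,
      HasDerivAt (fun s => g' s / (η (Real.exp (g s)) * Real.exp (h s)))
        (2 * lam * Real.exp (h t) * (η (Real.exp (g t))) ^ 2 *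
          η' (Real.exp (g t)) * Real.exp (g t)) t) :
    (∀ t ∈ Set.Icc (0 : ℝ) 1,
      (1 / 2) * (g' t / (η (Real.exp (g t)) * Real.exp (h t))) ^ 2 =
        lam * ((η (Real.exp (g t))) ^ 2 - (η (Real.exp (g 1))) ^ 2)) ∧
    ((∫ t in (0 : ℝ)..1, Real.exp (h t) * (η (Real.exp (g t))) ^ 2) = K →
      (∫ t in (0 : ℝ)..1,
          (1 / 2) * (g' t / (η (Real.exp (g t)) * Real.sqrt (Real.exp (h t)))) ^ 2) =
        lam * (K - (η (Real.exp (g 1))) ^ 2 * ∫ t in (0 : ℝ)..1, Real.exp (h t))) := by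
  have hηg : ∀ t ∈ Set.Icc (0 : ℝ) 1, HasDerivAt (fun s => η (Real.exp (g s)))
      (η' (Real.exp (g t)) * (Real.exp (g t) * g' t)) t := fun t ht =>
    (hη' _ (Real.exp_pos (g t))).comp t (hg t ht).exp
  have hconserved : ∀ t ∈ Set.Icc (0 : ℝ) 1,
      HasDerivAt (fun s => (1 / 2) * (g' s / (η (Real.exp (g s)) * Real.exp (h s))) ^ 2 -
        lam * (η (Real.exp (g s))) ^ 2) 0 t := by
    intro t ht
    refine ((((hEL t ht).pow 2).const_mul (1 / 2)).sub
      (((hηg t ht).pow 2).const_mul lam)).congr_deriv ?_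
    have hη0 := (hηpos _ (Real.exp_pos (g t))).ne'
    have hexp0 := (Real.exp_pos (h t)).ne'
    simp only [Nat.cast_ofNat, Nat.add_one_sub_one, pow_one]
    field_simp
    ring
  have hconst := constant_of_has_deriv_right_zero
    (fun t ht => (hconserved t ht).continuousAt.continuousWithinAt)
    (fun t ht => (hconserved t (Set.Ico_subset_Icc_self ht)).hasDerivWithinAt)
  have hfirst : ∀ t ∈ Set.Icc (0 : ℝ) 1,
      (1 / 2) * (g' t / (η (Real.exp (g t)) * Real.exp (h t))) ^ 2 =
        lam * ((η (Real.exp (g t))) ^ 2 - (η (Real.exp (g 1))) ^ 2) := by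
    intro t ht
    have key := (hconst t ht).trans (hconst 1 (by simp)).symm
    simp only [hg'1, zero_div] at key
    linarith
  refine ⟨hfirst, fun hconstraint => ?_⟩
  have hexp : ContinuousOn (fun t => Real.exp (h t)) (Set.uIcc (0 : ℝ) 1) := by
    rw [Set.uIcc_of_le zero_le_one]
    exact fun t ht => (hh t ht).exp.continuousAt.continuousWithinAt
  have hη : ContinuousOn (fun t => η (Real.exp (g t))) (Set.uIcc (0 : ℝ) 1) := by
    rw [Set.uIcc_of_le zero_le_one]
    exact fun t ht => (hηg t ht).continuousAt.continuousWithinAt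
  have hweighted : ContinuousOn (fun t => Real.exp (h t) * (η (Real.exp (g t))) ^ 2)
      (Set.uIcc (0 : ℝ) 1) := hexp.mul (hη.pow 2)
  rw [← hconstraint, ← intervalIntegral.integral_const_mul,
    ← intervalIntegral.integral_sub hweighted.intervalIntegrable
      (hexp.intervalIntegrable.const_mul _),
    ← intervalIntegral.integral_const_mul]
  refine intervalIntegral.integral_congr fun t ht => ?_
  rw [Set.uIcc_of_le zero_le_one] at ht
  have hη0 := (hηpos _ (Real.exp_pos (g t))).ne'
  have hexp0 := (Real.exp_pos (h t)).ne'
  calc (1 / 2) * (g' t / (η (Real.exp (g t)) * Real.sqrt (Real.exp (h t)))) ^ 2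
      = Real.exp (h t) *
          ((1 / 2) * (g' t / (η (Real.exp (g t)) * Real.exp (h t))) ^ 2) := by
        rw [div_pow, mul_pow, Real.sq_sqrt (Real.exp_pos _).le]
        field_simp
    _ = lam * (Real.exp (h t) * (η (Real.exp (g t))) ^ 2 -
          (η (Real.exp (g 1))) ^ 2 * Real.exp (h t)) := by
        rw [hfirst t ht]
        ring
end

section
/- Let ρ ∈ (−1,1), σ₀ > 0, η₀ > 0, V₀ > 0 and η₁ ∈ ℝ, set D := σ₀² + 4ρσ₀√V₀ η₁ + 4η₁² V₀ and assume D > 0. Define g₁(t) := (3/2) · ((2√V₀ η₁ + ρσ₀)√V₀ η₀ / D) · (2t − t²) and h₁(t) := (3/2) · (σ₀(σ₀ + 2ρ√V₀ η₁) / D) · (2t − t²) for t ∈ [0,1]. Then (1/(2(1−ρ²))) ∫₀¹ ( g₁'(t)/(η₀√V₀) − ρ h₁'(t)/σ₀ )² dt + (1/2) ∫₀¹ ( h₁'(t)/σ₀ )² dt = 3/(2D), and moreover ∫₀¹ h₁(t) dt + (2η₁/η₀) ∫₀¹ g₁(t) dt = 1. -/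
open MeasureTheory

theorem deriv_const_mul_two_mul_sub_sq (c t : ℝ) :
    deriv (fun t : ℝ => c * (2 * t - t ^ 2)) t = c * (2 - 2 * t) := by
  have h : HasDerivAt (fun t : ℝ => c * (2 * t - t ^ 2)) (c * (2 * 1 - 2 * t)) t := by
    simpa using (((hasDerivAt_id t).const_mul 2).sub (hasDerivAt_pow 2 t)).const_mul c
  rw [h.deriv, mul_one]

theorem integral_const_mul_one_sub_sq (c : ℝ) :
    ∫ t in (0 : ℝ)..1, c * (1 - t) ^ 2 = c / 3 := by
  rw [intervalIntegral.integral_const_mul,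
    intervalIntegral.integral_comp_sub_left (fun t : ℝ => t ^ 2) 1, integral_pow]
  norm_num
  ring

theorem integral_const_mul_two_mul_sub_sq (c : ℝ) :
    ∫ t in (0 : ℝ)..1, c * (2 * t - t ^ 2) = c * (2 / 3) := by
  rw [intervalIntegral.integral_const_mul, intervalIntegral.integral_sub
    (Continuous.intervalIntegrable (by fun_prop) _ _)
    (Continuous.intervalIntegrable (by fun_prop) _ _),
    intervalIntegral.integral_const_mul, integral_id, integral_pow]
  norm_num

/-- for the explicit first-order functions `g₁, h₁` of the expansion around
the ATM point, the quadratic action evaluates to `3/(2D)` and the normalization condition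
`∫₀¹ h₁ + (2η₁/η₀)∫₀¹ g₁ = 1` holds. -/
theorem first_order_expansion_functions
    (ρ σ₀ η₀ V₀ η₁ D : ℝ)
    (hρ : ρ ∈ Set.Ioo (-1 : ℝ) 1) (hσ₀ : 0 < σ₀) (hη₀ : 0 < η₀) (hV₀ : 0 < V₀)
    (hD : D = σ₀ ^ 2 + 4 * ρ * σ₀ * Real.sqrt V₀ * η₁ + 4 * η₁ ^ 2 * V₀)
    (hDpos : 0 < D)
    (g₁ h₁ : ℝ → ℝ)
    (hg₁ : g₁ = fun t =>
      (3 / 2) * ((2 * Real.sqrt V₀ * η₁ + ρ * σ₀) * Real.sqrt V₀ * η₀ / D) *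
        (2 * t - t ^ 2))
    (hh₁ : h₁ = fun t =>
      (3 / 2) * (σ₀ * (σ₀ + 2 * ρ * Real.sqrt V₀ * η₁) / D) * (2 * t - t ^ 2)) :
    ((1 / (2 * (1 - ρ ^ 2))) *
        (∫ t in (0 : ℝ)..1,
          (deriv g₁ t / (η₀ * Real.sqrt V₀) - ρ * deriv h₁ t / σ₀) ^ 2) +
      (1 / 2) * (∫ t in (0 : ℝ)..1, (deriv h₁ t / σ₀) ^ 2) = 3 / (2 * D)) ∧
    ((∫ t in (0 : ℝ)..1, h₁ t) + (2 * η₁ / η₀) * (∫ t in (0 : ℝ)..1, g₁ t) = 1) := by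
  obtain ⟨hρ₁, hρ₂⟩ := hρ
  have hρ_sq : 1 - ρ ^ 2 ≠ 0 := by nlinarith
  have hs : 0 < √V₀ := Real.sqrt_pos.mpr hV₀
  have hs_sq : √V₀ ^ 2 = V₀ := Real.sq_sqrt hV₀.le
  subst hg₁ hh₁
  simp only [deriv_const_mul_two_mul_sub_sq, integral_const_mul_two_mul_sub_sq]
  generalize √V₀ = s at *
  rw [← hs_sq] at hD
  have hσ : σ₀ ≠ 0 := hσ₀.ne'
  have hη : η₀ ≠ 0 := hη₀.ne'
  have hs₀ : s ≠ 0 := hs.ne'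
  have hD₀ : D ≠ 0 := hDpos.ne'
  constructor
  · have hA (t : ℝ) :
        ((3 / 2) * ((2 * s * η₁ + ρ * σ₀) * s * η₀ / D) * (2 - 2 * t) / (η₀ * s) -
          ρ * ((3 / 2) * (σ₀ * (σ₀ + 2 * ρ * s * η₁) / D) * (2 - 2 * t)) / σ₀) ^ 2 =
        (3 * (2 * s * η₁) * (1 - ρ ^ 2) / D) ^ 2 * (1 - t) ^ 2 := by
      field_simp
      ring
    have hB (t : ℝ) :
        ((3 / 2) * (σ₀ * (σ₀ + 2 * ρ * s * η₁) / D) * (2 - 2 * t) / σ₀) ^ 2 =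
        (3 * (σ₀ + 2 * ρ * s * η₁) / D) ^ 2 * (1 - t) ^ 2 := by
      field_simp
    simp only [hA, hB, integral_const_mul_one_sub_sq]
    field_simp
    rw [hD]
    ring
  · field_simp
    rw [hD]
    ring
end
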